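/- arXiv:2212.10329 — 4 statements merged into one kernel-verified Lean document; each statement's English description precedes it below -/
import Mathlib

section
/- The group homomorphism ρ : F_2 → GL(2, ℤ) determined on the two free generators by ρ(X_1) = [[1, 2], [0, 1]] and ρ(X_2) = [[1, 0], [2, 1]] is injective. In particular, the matrices [[1,2],[0,1]] and [[1,0],[2,1]] generate a free subgroup of rank 2 of GL(2, ℤ). -/
/-- The matrix `[[1, 2], [0, 1]]` as an element of `GL(2, ℤ)`. -/
def stmt4M1 : Matrix.GeneralLinearGroup (Fin 2) ℤ :=
  ⟨!![1, 2; 0, 1], !![1, -2; 0, 1], by decide, by decide⟩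

/-- The matrix `[[1, 0], [2, 1]]` as an element of `GL(2, ℤ)`. -/
def stmt4M2 : Matrix.GeneralLinearGroup (Fin 2) ℤ :=
  ⟨!![1, 0; 2, 1], !![1, 0; -2, 1], by decide, by decide⟩

open scoped Function Pointwise in
/-- A ping-pong criterion for freeness, phrased in terms of nontrivial integer powers. -/
theorem FreeGroup.injective_lift_of_zpow_ping_pong {ι G α : Type*} [Nontrivial ι] [Group G]
    [MulAction G α] (a : ι → G) (X : ι → Set α) (hXnonempty : ∀ i, (X i).Nonempty)
    (hXdisj : Pairwise (Disjoint on X))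
    (hX : Pairwise fun i j => ∀ n : ℤ, n ≠ 0 → a i ^ n • X j ⊆ X i) :
    Function.Injective (FreeGroup.lift a) := by
  have hlift : FreeGroup.lift a =
      (Monoid.CoprodI.lift fun i => FreeGroup.lift fun _ : Unit => a i).comp
        (freeGroupEquivCoprodI (ι := ι)).toMonoidHom := by
    ext i
    simp
  rw [hlift, MonoidHom.coe_comp]
  refine Function.Injective.comp ?_ freeGroupEquivCoprodI.injective
  refine Monoid.CoprodI.lift_injective_of_ping_pong _ (Or.inr ?_) X hXnonempty hXdisj ?_
  · refine ⟨Classical.arbitrary ι, ?_⟩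
    rw [FreeGroup.freeGroupUnitEquivInt.cardinal_eq, Cardinal.mk_denumerable]
    exact Cardinal.natCast_le_aleph0
  · intro i j hij h hne
    obtain ⟨n, rfl⟩ := FreeGroup.freeGroupUnitEquivInt.symm.surjective h
    change FreeGroup.lift (fun _ => a i) (FreeGroup.of () ^ n) • X j ⊆ X i
    rw [map_zpow, FreeGroup.lift_apply_of]
    refine hX hij n ?_
    rintro rfl
    exact hne (by simp [FreeGroup.freeGroupUnitEquivInt])

theorem coe_stmt4M1_zpow (n : ℤ) :
    ((stmt4M1 ^ n : Matrix.GeneralLinearGroup (Fin 2) ℤ) : Matrix (Fin 2) (Fin 2) ℤ) =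
      !![1, 2 * n; 0, 1] := by
  induction n using Int.induction_on with
  | zero => simp [Matrix.one_fin_two]
  | succ k ih =>
    rw [zpow_add_one, Units.val_mul, ih]
    simp [stmt4M1]
    ring
  | pred k ih =>
    rw [zpow_sub_one, Units.val_mul, ih, ← Units.inv_eq_val_inv]
    simp [stmt4M1]
    ring

theorem coe_stmt4M2_zpow (n : ℤ) :
    ((stmt4M2 ^ n : Matrix.GeneralLinearGroup (Fin 2) ℤ) : Matrix (Fin 2) (Fin 2) ℤ) =
      !![1, 0; 2 * n, 1] := by
  induction n using Int.induction_on with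
  | zero => simp [Matrix.one_fin_two]
  | succ k ih =>
    rw [zpow_add_one, Units.val_mul, ih]
    simp [stmt4M2]
    ring
  | pred k ih =>
    rw [zpow_sub_one, Units.val_mul, ih, ← Units.inv_eq_val_inv]
    simp [stmt4M2]
    ring

theorem abs_lt_abs_add_two_mul_mul {x y n : ℤ} (hn : n ≠ 0) (h : |x| < |y|) :
    |y| < |x + 2 * n * y| := by
  have hn' : 1 ≤ |n| := Int.one_le_abs hn
  have hmul : |2 * n * y| = 2 * |n| * |y| := by simp [abs_mul]
  have hsub : |2 * n * y| - |x| ≤ |x + 2 * n * y| := by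
    simpa [add_comm] using abs_sub_abs_le_abs_sub (2 * n * y) (-x)
  nlinarith [abs_nonneg y]

theorem injective_lift_stmt4M1_stmt4M2 :
    Function.Injective (FreeGroup.lift ![stmt4M1, stmt4M2]) := by
  let X : Fin 2 → Set (Matrix (Fin 2) (Fin 2) ℤ) :=
    ![{A | |A 1 0| < |A 0 0|}, {A | |A 0 0| < |A 1 0|}]
  refine FreeGroup.injective_lift_of_zpow_ping_pong _ X ?_ ?_ ?_
  · intro i
    fin_cases i
    · exact ⟨!![1, 0; 0, 0], by simp [X]⟩
    · exact ⟨!![0, 0; 1, 0], by simp [X]⟩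
  · intro i j hij
    rw [Function.onFun, Set.disjoint_left]
    fin_cases i <;> fin_cases j <;> simp_all [X, le_of_lt]
  · intro i j hij n hn
    rintro _ ⟨A, hA, rfl⟩
    fin_cases i <;> fin_cases j
    · exact absurd rfl hij
    · simpa [X, Units.smul_def, -Matrix.coe_units_zpow, coe_stmt4M1_zpow, Matrix.vecMul_eq_sum,
        Fin.sum_univ_two] using abs_lt_abs_add_two_mul_mul hn hA
    · simpa [X, Units.smul_def, -Matrix.coe_units_zpow, coe_stmt4M2_zpow, Matrix.vecMul_eq_sum,
        Fin.sum_univ_two, add_comm] using abs_lt_abs_add_two_mul_mul hn hA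
    · exact absurd rfl hij

/-- The homomorphism `ρ : F_2 → GL(2, ℤ)` with `ρ(X_1) = [[1,2],[0,1]]` and
`ρ(X_2) = [[1,0],[2,1]]` is injective; in particular the two matrices generate
a free subgroup of `GL(2, ℤ)` of rank `2`. -/
theorem stmt_4 :
    Function.Injective ⇑(FreeGroup.lift ![stmt4M1, stmt4M2]) ∧
    Nonempty ((Subgroup.closure {stmt4M1, stmt4M2} :
      Subgroup (Matrix.GeneralLinearGroup (Fin 2) ℤ)) ≃* FreeGroup (Fin 2)) := by
  refine ⟨injective_lift_stmt4M1_stmt4M2, ⟨?_⟩⟩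
  have hclosure : Subgroup.closure {stmt4M1, stmt4M2} =
      (FreeGroup.lift ![stmt4M1, stmt4M2]).range := by
    rw [FreeGroup.range_lift_eq_closure, Matrix.range_cons_cons_empty]
  exact (MulEquiv.subgroupCongr hclosure).trans
    (MonoidHom.ofInjective injective_lift_stmt4M1_stmt4M2).symm
end

section
/- Let G be a group and S a finite symmetric subset of G (S = S^{−1}) not containing the identity, and let g ∈ G. Then there exist two finite Borel measures μ_+ and μ_− on ℝ, each supported in the interval [−|S|, |S|], such that for every n ∈ ℕ, the number N_g(n) of n-tuples (s_1, …, s_n) ∈ S^n with product g^{−1} satisfies N_g(n) = ∫_ℝ x^n dμ_+(x) − ∫_ℝ x^n dμ_−(x). -/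
open MeasureTheory

open scoped InnerProductSpace ENNReal CompactlySupported

section SpectralMeasure

variable {E : Type*} [NormedAddCommGroup E] [InnerProductSpace ℂ E] [CompleteSpace E]

/-- The positive functional `f ↦ ⟪v, f(A) v⟫` on continuous functions on the spectrum of `A`. -/
noncomputable def spectralFunctional {A : E →L[ℂ] E} (hA : IsSelfAdjoint A) (v : E) :
    C_c(spectrum ℝ A, ℝ) →ₚ[ℝ] ℝ :=
  PositiveLinearMap.mk₀
    { toFun := fun f => (⟪v, cfcHom hA (f : C(spectrum ℝ A, ℝ)) v⟫_ℂ).re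
      map_add' := fun f h => by
        have : ((f + h : C_c(spectrum ℝ A, ℝ)) : C(spectrum ℝ A, ℝ))
            = (f : C(spectrum ℝ A, ℝ)) + (h : C(spectrum ℝ A, ℝ)) := rfl
        rw [this, map_add, add_apply, inner_add_right, Complex.add_re]
      map_smul' := fun c f => by
        have : ((c • f : C_c(spectrum ℝ A, ℝ)) : C(spectrum ℝ A, ℝ))
            = c • (f : C(spectrum ℝ A, ℝ)) := rfl
        rw [this, map_smul, smul_apply, inner_smul_right_eq_smul]
        simp }
    (fun f hf => by
      have h : 0 ≤ cfcHom hA (f : C(spectrum ℝ A, ℝ)) :=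
        (cfcHom_nonneg_iff hA).2 fun x => hf x
      rw [ContinuousLinearMap.nonneg_iff_isPositive] at h
      exact h.re_inner_nonneg_right v)

/-- Spectral measure of a bounded self-adjoint operator at a vector. -/
theorem exists_measure_moments_eq_inner {A : E →L[ℂ] E} (hA : IsSelfAdjoint A) {R : ℝ}
    (hR : ‖A‖ ≤ R) (v : E) :
    ∃ μ : Measure ℝ, IsFiniteMeasure μ ∧ μ (Set.Icc (-R) R)ᶜ = 0 ∧
      ∀ n : ℕ, ∫ x, x ^ n ∂μ = (⟪v, (A ^ n) v⟫_ℂ).re := by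
  refine ⟨(RealRMK.rieszMeasure (spectralFunctional hA v)).map Subtype.val, inferInstance, ?_,
    fun n => ?_⟩
  · rw [Measure.map_apply measurable_subtype_coe measurableSet_Icc.compl]
    convert measure_empty (μ := RealRMK.rieszMeasure (spectralFunctional hA v))
    rw [Set.preimage_compl, Set.compl_empty_iff, Set.eq_univ_iff_forall]
    rintro ⟨k, hk⟩
    have h1 : ‖k‖ ≤ ‖A‖ * ‖(1 : E →L[ℂ] E)‖ := spectrum.norm_le_norm_mul_of_mem hk
    have h2 : ‖(1 : E →L[ℂ] E)‖ ≤ 1 := ContinuousLinearMap.norm_id_le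
    have h3 : |k| ≤ R := by
      rw [Real.norm_eq_abs] at h1
      nlinarith [norm_nonneg A]
    exact abs_le.1 h3
  · rw [(MeasurableEmbedding.subtype_coe
      (spectrum.isClosed (𝕜 := ℝ) A).measurableSet).integral_map]
    let p : C(spectrum ℝ A, ℝ) := (ContinuousMap.restrict (spectrum ℝ A) (.id ℝ)) ^ n
    have h := RealRMK.integral_rieszMeasure (spectralFunctional hA v)
      (CompactlySupportedContinuousMap.continuousMapEquiv p)
    refine h.trans ?_
    change (⟪v, cfcHom hA p v⟫_ℂ).re = _
    rw [map_pow, cfcHom_id hA]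

/-- Polarized form of `exists_measure_moments_eq_inner`. -/
theorem exists_measures_moments_sub_eq_inner {A : E →L[ℂ] E} (hA : IsSelfAdjoint A) {R : ℝ}
    (hR : ‖A‖ ≤ R) (a b : E) :
    ∃ μp μm : Measure ℝ, IsFiniteMeasure μp ∧ IsFiniteMeasure μm ∧
      μp (Set.Icc (-R) R)ᶜ = 0 ∧ μm (Set.Icc (-R) R)ᶜ = 0 ∧
      ∀ n : ℕ, (⟪b, (A ^ n) a⟫_ℂ).re = (∫ x, x ^ n ∂μp) - ∫ x, x ^ n ∂μm := by
  obtain ⟨μp, hp, hp', hpn⟩ := exists_measure_moments_eq_inner hA hR ((1 / 2 : ℂ) • (a + b))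
  obtain ⟨μm, hm, hm', hmn⟩ := exists_measure_moments_eq_inner hA hR ((1 / 2 : ℂ) • (a - b))
  refine ⟨μp, μm, hp, hm, hp', hm', fun n => ?_⟩
  have hsymm : (⟪a, (A ^ n) b⟫_ℂ).re = (⟪b, (A ^ n) a⟫_ℂ).re := by
    have h : ⟪(A ^ n) a, b⟫_ℂ = ⟪a, (A ^ n) b⟫_ℂ := (hA.pow n).isSymmetric a b
    rw [← h]
    exact inner_re_symm (𝕜 := ℂ) _ _
  rw [hpn, hmn]
  simp only [map_smul, map_add, map_sub, inner_smul_left, inner_smul_right, inner_add_left,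
    inner_add_right, inner_sub_left, inner_sub_right]
  have hhalf : (starRingEnd ℂ) (1 / 2 : ℂ) = ((1 / 2 : ℝ) : ℂ) := by
    rw [← Complex.conj_ofReal]; norm_num
  have hhalf' : (1 / 2 : ℂ) = ((1 / 2 : ℝ) : ℂ) := by norm_num
  rw [hhalf, hhalf']
  simp only [Complex.re_ofReal_mul, Complex.add_re, Complex.sub_re, hsymm]
  ring

end SpectralMeasure

section Translation

variable {G : Type*} [Group G]

/-- Left translation `f ↦ f (s * ·)` on `ℓ²(G)`. -/
noncomputable def lpTranslation (s : G) : lp (fun _ : G => ℂ) 2 →ₗᵢ[ℂ] lp (fun _ : G => ℂ) 2 where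
  toFun f := ⟨fun x => f (s * x), by
    have h2 : 0 < (2 : ℝ≥0∞).toReal := by norm_num
    exact (memℓp_gen_iff h2).2
      (((memℓp_gen_iff h2).1 (lp.memℓp f)).comp_injective (mul_right_injective s))⟩
  map_add' _ _ := rfl
  map_smul' _ _ := rfl
  norm_map' f := by
    have h2 : 0 < (2 : ℝ≥0∞).toReal := by norm_num
    rw [lp.norm_eq_tsum_rpow h2, lp.norm_eq_tsum_rpow h2]
    congr 1
    exact (Equiv.mulLeft s).tsum_eq fun x => ‖f x‖ ^ (2 : ℝ≥0∞).toReal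

theorem lpTranslation_apply (s : G) (f : lp (fun _ : G => ℂ) 2) (x : G) :
    lpTranslation s f x = f (s * x) := rfl

theorem inner_lpTranslation_left (s : G) (f h : lp (fun _ : G => ℂ) 2) :
    ⟪lpTranslation s f, h⟫_ℂ = ⟪f, lpTranslation s⁻¹ h⟫_ℂ := by
  rw [lp.inner_eq_tsum, lp.inner_eq_tsum,
    ← (Equiv.mulLeft s).tsum_eq fun x => ⟪f x, lpTranslation s⁻¹ h x⟫_ℂ]
  simp [lpTranslation_apply]

/-- The adjacency operator of the Cayley graph `C(G, S)` on `ℓ²(G)`. -/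
noncomputable def cayleyAdjacency (S : Finset G) :
    lp (fun _ : G => ℂ) 2 →L[ℂ] lp (fun _ : G => ℂ) 2 :=
  ∑ s : S, (lpTranslation (s : G)).toContinuousLinearMap

theorem cayleyAdjacency_apply (S : Finset G) (f : lp (fun _ : G => ℂ) 2) :
    cayleyAdjacency S f = ∑ s : S, lpTranslation (s : G) f := by
  simp [cayleyAdjacency]

theorem norm_cayleyAdjacency_le (S : Finset G) : ‖cayleyAdjacency S‖ ≤ S.card := by
  refine (norm_sum_le _ _).trans ?_
  refine (Finset.sum_le_card_nsmul _ _ 1 fun (s : S) _ =>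
    (lpTranslation (s : G)).norm_toContinuousLinearMap_le).trans ?_
  simp

theorem isSelfAdjoint_cayleyAdjacency {S : Finset G} (hsym : ∀ s ∈ S, s⁻¹ ∈ S) :
    IsSelfAdjoint (cayleyAdjacency S) := by
  rw [ContinuousLinearMap.isSelfAdjoint_iff_isSymmetric]
  intro f h
  let e : S ≃ S :=
    { toFun := fun s => ⟨(s : G)⁻¹, hsym s s.2⟩
      invFun := fun s => ⟨(s : G)⁻¹, hsym s s.2⟩
      left_inv := fun s => by simp
      right_inv := fun s => by simp }
  change ⟪cayleyAdjacency S f, h⟫_ℂ = ⟪f, cayleyAdjacency S h⟫_ℂ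
  rw [cayleyAdjacency_apply, cayleyAdjacency_apply, sum_inner, inner_sum, ← e.sum_comp]
  refine Finset.sum_congr rfl fun s _ => ?_
  rw [inner_lpTranslation_left]
  simp [e]

theorem cayleyAdjacency_pow_apply (S : Finset G) (n : ℕ) (f : lp (fun _ : G => ℂ) 2) (x : G) :
    (cayleyAdjacency S ^ n) f x =
      ∑ t : Fin n → S, f ((List.ofFn fun i => (t i : G)).prod * x) := by
  induction n generalizing f with
  | zero => simp
  | succ n ih =>
    rw [pow_succ, mul_apply_eq_comp, ih,
      ← (Fin.consEquiv fun _ : Fin (n + 1) => S).sum_comp, Fintype.sum_prod_type,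
      Finset.sum_comm]
    refine Finset.sum_congr rfl fun t _ => ?_
    rw [cayleyAdjacency_apply, lp.coeFn_sum, Finset.sum_apply]
    refine Finset.sum_congr rfl fun s _ => ?_
    rw [lpTranslation_apply]
    simp [Fin.consEquiv, List.ofFn_succ, mul_assoc]

open scoped Classical in
theorem inner_cayleyAdjacency_pow (S : Finset G) (n : ℕ) (g : G) :
    ⟪(lp.single 2 g 1 : lp (fun _ : G => ℂ) 2), (cayleyAdjacency S ^ n) (lp.single 2 1 1)⟫_ℂ =
      (Nat.card {t : Fin n → S // (List.ofFn fun i => (t i : G)).prod = g⁻¹} : ℂ) := by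
  rw [lp.inner_single_left, cayleyAdjacency_pow_apply, Nat.card_eq_fintype_card,
    Fintype.card_subtype]
  simp [lp.single_apply, Pi.single_apply, mul_eq_one_iff_eq_inv]

end Translation

/-- Let `S` be a finite symmetric subset of a group `G` not containing the identity
and let `g ∈ G`.  Then there are two finite Borel measures `μ₊`, `μ₋` on `ℝ`, each
supported in `[−|S|, |S|]`, such that for every `n`, the number `N_g(n)` of `n`-tuples
from `S` with product `g⁻¹` equals `∫ x^n dμ₊ − ∫ x^n dμ₋`. -/
theorem stmt_12 {G : Type*} [Group G] (S : Finset G)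
    (hsym : ∀ s ∈ S, s⁻¹ ∈ S) (hone : (1 : G) ∉ S) (g : G) :
    ∃ μp μm : Measure ℝ,
      IsFiniteMeasure μp ∧ IsFiniteMeasure μm ∧
      μp (Set.Icc (-(S.card : ℝ)) (S.card : ℝ))ᶜ = 0 ∧
      μm (Set.Icc (-(S.card : ℝ)) (S.card : ℝ))ᶜ = 0 ∧
      ∀ n : ℕ,
        (Nat.card {t : Fin n → S // (List.ofFn fun i => (t i : G)).prod = g⁻¹} : ℝ)
          = (∫ x, x ^ n ∂μp) - ∫ x, x ^ n ∂μm := by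
  classical
  obtain ⟨μp, μm, hp, hm, hp', hm', h⟩ := exists_measures_moments_sub_eq_inner
    (isSelfAdjoint_cayleyAdjacency hsym) (norm_cayleyAdjacency_le S)
    (lp.single 2 1 1) (lp.single 2 g 1)
  refine ⟨μp, μm, hp, hm, hp', hm', fun n => ?_⟩
  rw [← h n]
  rw [← Complex.natCast_re, ← inner_cayleyAdjacency_pow S n g]
end

section
/- (Kesten) Let m ≥ 1 and let F_m be the free group on m generators. Let S ⊂ F_m be the symmetric set consisting of the m free generators and their inverses, so |S| = 2m =: v. Define the adjacency operator A on ℓ²(F_m) by (A f)(g) = Σ_{s ∈ S} f(s^{−1} g). Then A is a bounded self-adjoint operator and its spectrum equals the interval [−2√(v−1), 2√(v−1)] = [−2√(2m−1), 2√(2m−1)]. -/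
open Filter Topology
open scoped InnerProductSpace

namespace FreeGroup

variable {α : Type*} [DecidableEq α]

theorem norm_mk_singleton_mul (s : α × Bool) (g : FreeGroup α) :
    (mk [s] * g).norm =
      if g.toWord.head? = some (s.1, !s.2) then g.norm - 1 else g.norm + 1 := by
  have h : (mk [s] * g).toWord = reduce (s :: g.toWord) := by
    rw [toWord_mul, toWord_mk, reduce_singleton, List.singleton_append]
  rw [norm, norm, h, reduce.cons, reduce_toWord]
  obtain ⟨a, b⟩ := s
  rcases g.toWord with _ | ⟨⟨c, d⟩, tl⟩
  · simp
  · by_cases hc : a = c <;> cases b <;> cases d <;> simp [hc, eq_comm]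

variable [Fintype α] {R : Type*} [CommRing R]

theorem sum_norm_mk_singleton (φ : ℕ → R) :
    ∑ s : α × Bool, φ (mk [s] * 1 : FreeGroup α).norm = 2 * Fintype.card α * φ 1 := by
  have h : ∀ s : α × Bool, (mk [s] * 1 : FreeGroup α).norm = 1 := fun s => by
    rw [norm_mk_singleton_mul, norm_one]; simp
  simp only [h, Finset.sum_const, Finset.card_univ, Fintype.card_prod, Fintype.card_bool,
    nsmul_eq_mul]
  push_cast
  ring

theorem sum_norm_mk_singleton_mul (φ : ℕ → R) {g : FreeGroup α} {n : ℕ} (hg : g.norm = n + 1) :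
    ∑ s : α × Bool, φ (mk [s] * g).norm = φ n + (2 * Fintype.card α - 1) * φ (n + 2) := by
  obtain ⟨⟨c, d⟩, tl, hw⟩ : ∃ t tl, g.toWord = t :: tl :=
    List.exists_cons_of_length_eq_add_one hg
  have key : ∀ s : α × Bool, φ (mk [s] * g).norm =
      φ (n + 2) + if s = (c, !d) then φ n - φ (n + 2) else 0 := by
    intro s
    have : ((c, d) :: tl).head? = some (s.1, !s.2) ↔ s = (c, !d) := by
      obtain ⟨a, b⟩ := s
      cases b <;> cases d <;> simp [eq_comm]
    rw [norm_mk_singleton_mul, hg, hw, if_congr this rfl rfl]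
    by_cases h : s = (c, !d)
    · rw [if_pos h, if_pos h]; simp
    · rw [if_neg h, if_neg h]; simp
  simp only [key, Finset.sum_add_distrib, Finset.sum_ite_eq', Finset.mem_univ, if_true,
    Finset.sum_const, Finset.card_univ, Fintype.card_prod, Fintype.card_bool, nsmul_eq_mul]
  push_cast
  ring

theorem finite_norm_eq (k : ℕ) : {g : FreeGroup α | g.norm = k}.Finite :=
  (List.finite_length_eq (α × Bool) k).preimage toWord_injective.injOn

end FreeGroup

theorem abs_eq_abs_of_sq_add_sq_eq_mul {u v c : ℝ} (hc : |c| ≤ 2) (h : u ^ 2 + v ^ 2 = c * (u * v)) :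
    |u| = |v| := by
  have h1 : c * (u * v) ≤ 2 * (|u| * |v|) := by
    calc c * (u * v) ≤ |c * (u * v)| := le_abs_self _
      _ = |c| * (|u| * |v|) := by rw [abs_mul, abs_mul]
      _ ≤ _ := by gcongr
  have h2 : (|u| - |v|) ^ 2 ≤ 0 := by nlinarith [sq_abs u, sq_abs v]
  nlinarith [pow_eq_zero_iff (two_ne_zero) |>.1 (le_antisymm h2 (sq_nonneg _))]

/-- A null sequence satisfying `u (k + 2) + u k = c u (k + 1)` with `|c| ≤ 2` vanishes. -/
theorem eq_zero_of_recurrence_of_tendsto {u : ℕ → ℝ} {c : ℝ} (hc : |c| ≤ 2)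
    (hu : ∀ k, u (k + 2) + u k = c * u (k + 1)) (h0 : Tendsto u atTop (𝓝 0)) (k : ℕ) :
    u k = 0 := by
  have hconst : ∀ k, u k ^ 2 + u (k + 1) ^ 2 - c * (u k * u (k + 1)) =
      u 0 ^ 2 + u 1 ^ 2 - c * (u 0 * u 1) := by
    intro k
    induction k with
    | zero => rfl
    | succ k ih => rw [← ih, eq_sub_of_add_eq (hu k)]; ring
  have h1 : Tendsto (fun k => u (k + 1)) atTop (𝓝 0) := (tendsto_add_atTop_iff_nat 1).2 h0
  have hlim : Tendsto (fun k => u k ^ 2 + u (k + 1) ^ 2 - c * (u k * u (k + 1))) atTop (𝓝 0) := by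
    simpa using ((h0.pow 2).add (h1.pow 2)).sub ((h0.mul h1).const_mul c)
  simp only [hconst] at hlim
  have hQ := tendsto_nhds_unique hlim tendsto_const_nhds
  have habs : ∀ k, |u k| = |u 0| := by
    intro k
    induction k with
    | zero => rfl
    | succ k ih =>
      rw [← ih]
      refine (abs_eq_abs_of_sq_add_sq_eq_mul hc ?_).symm
      linarith [hconst k]
  have h2 := h0.abs
  simp only [habs, abs_zero] at h2
  have := tendsto_nhds_unique h2 tendsto_const_nhds
  rw [← abs_eq_zero, habs k]
  exact this.symm

theorem Complex.eq_zero_of_recurrence_of_tendsto {b : ℕ → ℂ} {c : ℝ} (hc : |c| ≤ 2)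
    (hb : ∀ k, b (k + 2) + b k = c * b (k + 1)) (h0 : Tendsto b atTop (𝓝 0)) (k : ℕ) :
    b k = 0 := by
  apply Complex.ext
  · refine _root_.eq_zero_of_recurrence_of_tendsto (u := fun k => (b k).re) hc (fun k => ?_) ?_ k
    · simpa using congrArg Complex.re (hb k)
    · simpa [Function.comp_def] using (Complex.continuous_re.tendsto 0).comp h0
  · refine _root_.eq_zero_of_recurrence_of_tendsto (u := fun k => (b k).im) hc (fun k => ?_) ?_ k
    · simpa using congrArg Complex.im (hb k)
    · simpa [Function.comp_def] using (Complex.continuous_im.tendsto 0).comp h0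

/-- The spectrum of a self-adjoint operator that acts on an orthogonal sequence as the radial part
of the adjacency operator of a `(q + 1)`-regular tree contains `[-2√q, 2√q]`. -/
theorem mem_spectrum_of_orthogonal_recurrence {H : Type*} [NormedAddCommGroup H]
    [InnerProductSpace ℂ H] [CompleteSpace H] {T : H →L[ℂ] H} (hT : IsSelfAdjoint T) {q : ℝ}
    (hq : 0 < q) {χ : ℕ → H} (horth : Pairwise fun i j => ⟪χ i, χ j⟫_ℂ = 0) (hχ : χ 0 ≠ 0)
    (h0 : T (χ 0) = χ 1) (h1 : T (χ 1) = χ 2 + ((q + 1 : ℝ) : ℂ) • χ 0)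
    (h2 : ∀ k, T (χ (k + 2)) = χ (k + 3) + (q : ℂ) • χ (k + 1))
    {r : ℝ} (hr : |r| ≤ 2 * √q) : (r : ℂ) ∈ spectrum ℂ T := by
  have hsym : ∀ x y, ⟪T x, y⟫_ℂ = ⟪x, T y⟫_ℂ := hT.isSymmetric
  have hsq : √q * √q = q := Real.mul_self_sqrt hq.le
  have hsq0 : 0 < √q := Real.sqrt_pos.2 hq
  intro hmem
  obtain ⟨f, hf⟩ : ∃ f, (r : ℂ) • f - T f = χ 0 := by
    obtain ⟨B, hB⟩ := hmem.exists_right_inv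
    exact ⟨B (χ 0), by simpa [Algebra.algebraMap_eq_smul_one] using congrArg (· (χ 0)) hB⟩
  have hf' : ∀ k, (r : ℂ) * ⟪χ k, f⟫_ℂ - ⟪T (χ k), f⟫_ℂ = ⟪χ k, χ 0⟫_ℂ := by
    intro k
    rw [hsym, ← hf, inner_sub_right, inner_smul_right]
  have hnorm1 : ∀ k, ‖χ (k + 2)‖ = √q * ‖χ (k + 1)‖ := by
    intro k
    have e1 : ⟪T (χ (k + 1)), χ (k + 2)⟫_ℂ = ⟪χ (k + 2), χ (k + 2)⟫_ℂ := by
      cases k with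
      | zero => rw [h1, inner_add_left, inner_smul_left, horth (i := 0) (by simp), mul_zero, add_zero]
      | succ k =>
        rw [h2, inner_add_left, inner_smul_left, horth (i := k + 1) (by simp), mul_zero, add_zero]
    rw [hsym, h2, inner_add_right, inner_smul_right, horth (by simp), zero_add,
      inner_self_eq_norm_sq_to_K, inner_self_eq_norm_sq_to_K] at e1
    replace e1 : (q : ℂ) * (‖χ (k + 1)‖ : ℂ) ^ 2 = (‖χ (k + 2)‖ : ℂ) ^ 2 := e1
    have e2 : q * ‖χ (k + 1)‖ ^ 2 = ‖χ (k + 2)‖ ^ 2 := by exact_mod_cast e1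
    have e3 : (√q * ‖χ (k + 1)‖) ^ 2 = ‖χ (k + 2)‖ ^ 2 := by rw [← e2, mul_pow, pow_two, hsq]
    exact ((sq_eq_sq₀ (by positivity) (by positivity)).1 e3).symm
  have hnorm : ∀ k, ‖χ (k + 1)‖ = √q ^ k * ‖χ 1‖ := by
    intro k
    induction k with
    | zero => simp
    | succ k ih => rw [hnorm1, ih]; ring
  have hχ1 : 0 < ‖χ 1‖ := by
    rw [norm_pos_iff]
    intro h
    have e : ⟪T (χ 1), χ 0⟫_ℂ = 0 := by rw [hsym, h0, h, inner_zero_left]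
    rw [h1, inner_add_left, inner_smul_left, horth (by simp), zero_add] at e
    rcases mul_eq_zero.1 e with e | e
    · have : q + 1 = 0 := by simpa [Complex.ext_iff] using e
      linarith
    · exact hχ (inner_self_eq_zero.1 e)
  set e : ℕ → H := fun k => ((‖χ (k + 1)‖⁻¹ : ℝ) : ℂ) • χ (k + 1) with he
  have hpos : ∀ k, 0 < ‖χ (k + 1)‖ := fun k => by rw [hnorm]; positivity
  have hortho : Orthonormal ℂ e := by
    refine ⟨fun k => ?_, fun i j hij => ?_⟩
    · rw [he]
      simp only [norm_smul, Complex.norm_real, norm_inv, norm_norm]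
      exact inv_mul_cancel₀ (hpos k).ne'
    · simp only [he, inner_smul_left, inner_smul_right]
      rw [horth (by simpa using hij), mul_zero, mul_zero]
  have hlim : Tendsto (fun k => ⟪e k, f⟫_ℂ) atTop (𝓝 0) := by
    have := (hortho.inner_products_summable (x := f)).tendsto_atTop_zero
    rw [tendsto_zero_iff_norm_tendsto_zero]
    simpa only [Real.sqrt_sq (norm_nonneg _), Real.sqrt_zero] using this.sqrt
  have hb : ∀ k, ⟪e k, f⟫_ℂ = ((√q ^ k * ‖χ 1‖ : ℝ) : ℂ)⁻¹ * ⟪χ (k + 1), f⟫_ℂ := by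
    intro k
    simp only [he, inner_smul_left, Complex.conj_ofReal]
    rw [hnorm, Complex.ofReal_inv]
  have hzero : ∀ k, ⟪e k, f⟫_ℂ = 0 := by
    refine Complex.eq_zero_of_recurrence_of_tendsto (c := r / √q) ?_ (fun k => ?_) hlim
    · rw [abs_div, abs_of_pos hsq0, div_le_iff₀ hsq0]; exact hr
    · have := hf' (k + 2)
      rw [h2, horth (by simp), inner_add_left, inner_smul_left, Complex.conj_ofReal,
        sub_eq_zero] at this
      have hs : (√q : ℂ) ≠ 0 := by exact_mod_cast hsq0.ne'
      have hx : (‖χ 1‖ : ℂ) ≠ 0 := by exact_mod_cast hχ1.ne'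
      have hqq : (q : ℂ) = √q * √q := by exact_mod_cast hsq.symm
      rw [hb, hb, hb]
      rw [hqq] at this
      push_cast
      field_simp
      linear_combination (-(√q : ℂ) ^ (2 * k + 2)) * this
  have ha : ∀ k, ⟪χ (k + 1), f⟫_ℂ = 0 := by
    intro k
    have h := hzero k
    rw [hb, mul_eq_zero, inv_eq_zero] at h
    refine h.resolve_left ?_
    exact_mod_cast (by positivity : √q ^ k * ‖χ 1‖ ≠ 0)
  have ha0 : ⟪χ 0, f⟫_ℂ = 0 := by
    have := hf' 1
    rw [h1, horth (by simp), inner_add_left, inner_smul_left, ha 0, ha 1] at this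
    have hne : ((q + 1 : ℝ) : ℂ) ≠ 0 := by exact_mod_cast (by positivity : q + 1 ≠ 0)
    simpa [Complex.conj_ofReal, -Complex.ofReal_add, hne] using this
  have := hf' 0
  rw [h0, ha 0, ha0] at this
  simp only [mul_zero, sub_zero] at this
  exact hχ (inner_self_eq_zero.1 this.symm)

namespace lp

variable {X : Type*}

theorem hasSum_norm_sq (f : lp (fun _ : X => ℂ) 2) : HasSum (fun x => ‖f x‖ ^ 2) (‖f‖ ^ 2) := by
  simpa using lp.hasSum_norm (p := 2) (by simp) f

/-- Composition with a permutation of the index type, as a bounded operator on `ℓ²`. -/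
noncomputable def compPerm (σ : Equiv.Perm X) :
    lp (fun _ : X => ℂ) 2 →L[ℂ] lp (fun _ : X => ℂ) 2 :=
  LinearMap.mkContinuous
    { toFun := fun f => ⟨fun x => f (σ x), memℓp_gen <|
        (σ.summable_iff (f := fun x => ‖f x‖ ^ (2 : ENNReal).toReal)).2
          ((lp.memℓp f).summable (by simp))⟩
      map_add' := fun _ _ => rfl
      map_smul' := fun _ _ => rfl } 1 fun f => by
    rw [one_mul]
    refine lp.norm_le_of_tsum_le (by simp) (norm_nonneg _) (le_of_eq ?_)
    rw [lp.norm_rpow_eq_tsum (by simp)]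
    exact σ.tsum_eq (fun x => ‖f x‖ ^ (2 : ENNReal).toReal)

@[simp]
theorem compPerm_apply (σ : Equiv.Perm X) (f : lp (fun _ : X => ℂ) 2) (x : X) :
    compPerm σ f x = f (σ x) := rfl

theorem adjoint_compPerm (σ : Equiv.Perm X) :
    ContinuousLinearMap.adjoint (compPerm σ) = compPerm σ⁻¹ := by
  symm
  rw [ContinuousLinearMap.eq_adjoint_iff]
  intro f g
  rw [lp.inner_eq_tsum, lp.inner_eq_tsum, ← σ.tsum_eq]
  simp

theorem sum_compPerm_apply {ι : Type*} (s : Finset ι) (σ : ι → Equiv.Perm X)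
    (f : lp (fun _ : X => ℂ) 2) (x : X) : (∑ i ∈ s, compPerm (σ i)) f x = ∑ i ∈ s, f (σ i x) := by
  rw [_root_.sum_apply, lp.coeFn_sum, Finset.sum_apply]
  rfl

/-- A Schur test for sums of permutation operators. -/
theorem norm_sum_compPerm_le {ι : Type*} [Fintype ι] (σ : ι → Equiv.Perm X) {h : X → ℝ}
    (hpos : ∀ x, 0 < h x) {c : ℝ} (hc : 0 ≤ c) (h1 : ∀ x, ∑ i, h (σ i x) ≤ c * h x)
    (h2 : ∀ x, ∑ i, h ((σ i)⁻¹ x) ≤ c * h x) : ‖∑ i, compPerm (σ i)‖ ≤ c := by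
  refine ContinuousLinearMap.opNorm_le_bound _ hc fun f => ?_
  set K : ι → X → ℝ := fun i x => h ((σ i)⁻¹ x) * (‖f x‖ ^ 2 / h x) with hK
  have hK0 : ∀ i x, 0 ≤ K i x := fun i x =>
    mul_nonneg (hpos _).le (div_nonneg (sq_nonneg _) (hpos _).le)
  have hKsum : ∀ x, ∑ i, K i x ≤ c * ‖f x‖ ^ 2 := by
    intro x
    rw [← Finset.sum_mul]
    refine (mul_le_mul_of_nonneg_right (h2 x) (div_nonneg (sq_nonneg _) (hpos _).le)).trans_eq ?_
    have := (hpos x).ne'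
    field_simp
  have hf := (hasSum_norm_sq f).mul_left c
  have hKs : ∀ i, Summable (K i) := fun i => hf.summable.of_nonneg_of_le (hK0 i) fun x =>
    (Finset.single_le_sum (fun j _ => hK0 j x) (Finset.mem_univ i)).trans (hKsum x)
  have hpt : ∀ x, ‖(∑ i, compPerm (σ i)) f x‖ ^ 2 ≤ c * ∑ i, K i (σ i x) := by
    intro x
    have hcs : (∑ i, ‖f (σ i x)‖) ^ 2 ≤
        (∑ i, h (σ i x)) * ∑ i, ‖f (σ i x)‖ ^ 2 / h (σ i x) :=
      Finset.sum_sq_le_sum_mul_sum_of_sq_le_mul _ (fun i _ => (hpos _).le)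
        (fun i _ => div_nonneg (sq_nonneg _) (hpos _).le)
        (fun i _ => (mul_div_cancel₀ _ (hpos _).ne').ge)
    calc ‖(∑ i, compPerm (σ i)) f x‖ ^ 2 ≤ (∑ i, ‖f (σ i x)‖) ^ 2 := by
          rw [sum_compPerm_apply]
          gcongr
          exact norm_sum_le _ _
      _ ≤ _ := hcs
      _ ≤ (c * h x) * ∑ i, ‖f (σ i x)‖ ^ 2 / h (σ i x) :=
          mul_le_mul_of_nonneg_right (h1 x)
            (Finset.sum_nonneg fun i _ => div_nonneg (sq_nonneg _) (hpos _).le)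
      _ = c * ∑ i, K i (σ i x) := by
          simp only [hK, Equiv.Perm.inv_def, Equiv.symm_apply_apply, mul_assoc, Finset.mul_sum]
  have hsum : HasSum (fun x => ∑ i, K i (σ i x)) (∑ i, ∑' x, K i x) :=
    hasSum_sum fun i _ => (σ i).hasSum_iff.2 (hKs i).hasSum
  have hle : ‖(∑ i, compPerm (σ i)) f‖ ^ 2 ≤ c * (c * ‖f‖ ^ 2) := by
    refine (hasSum_le hpt (hasSum_norm_sq _) (hsum.mul_left c)).trans ?_
    exact mul_le_mul_of_nonneg_left
      (hasSum_le hKsum (hasSum_sum fun i _ => (hKs i).hasSum) hf) hc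
  refine le_of_sq_le_sq ?_ (by positivity)
  rw [mul_pow]
  linarith

end lp

namespace FreeGroup

variable {α : Type*}

theorem inv_mk_singleton (s : α × Bool) : (mk [s])⁻¹ = mk [(s.1, !s.2)] := by
  rw [inv_mk]; rfl

variable [Fintype α]

/-- The adjacency operator of the Cayley graph of a free group with respect to its basis. -/
noncomputable def adjacency (α : Type*) [Fintype α] :
    lp (fun _ : FreeGroup α => ℂ) 2 →L[ℂ] lp (fun _ : FreeGroup α => ℂ) 2 :=
  ∑ s : α × Bool, lp.compPerm (Equiv.mulLeft (mk [s]))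

theorem adjacency_apply (f : lp (fun _ : FreeGroup α => ℂ) 2) (g : FreeGroup α) :
    adjacency α f g = ∑ s : α × Bool, f (mk [s] * g) :=
  lp.sum_compPerm_apply _ _ _ _

theorem sum_inv_mk_singleton {M : Type*} [AddCommMonoid M] (φ : FreeGroup α → M) :
    ∑ s : α × Bool, φ (mk [s])⁻¹ = ∑ s : α × Bool, φ (mk [s]) := by
  simp only [inv_mk_singleton, Fintype.sum_prod_type, Fintype.sum_bool, Bool.not_true,
    Bool.not_false, add_comm]

theorem isSelfAdjoint_adjacency : IsSelfAdjoint (adjacency α) := by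
  rw [IsSelfAdjoint, adjacency, star_sum]
  simp only [ContinuousLinearMap.star_eq_adjoint, lp.adjoint_compPerm, Equiv.inv_mulLeft]
  exact sum_inv_mk_singleton fun h => lp.compPerm (Equiv.mulLeft h)

variable [DecidableEq α]

theorem norm_adjacency_le [Nonempty α] :
    ‖adjacency α‖ ≤ 2 * √(2 * (Fintype.card α : ℝ) - 1) := by
  have hcard : (1 : ℝ) ≤ Fintype.card α := by exact_mod_cast Fintype.card_pos
  set q : ℝ := 2 * (Fintype.card α : ℝ) - 1 with hq
  have hq1 : 1 ≤ q := by linarith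
  have hs : 1 ≤ √q := Real.one_le_sqrt.2 hq1
  have hs0 : √q ≠ 0 := by positivity
  have hsq : √q * √q = q := Real.mul_self_sqrt (by linarith)
  have key : ∀ g : FreeGroup α,
      ∑ s : α × Bool, (√q)⁻¹ ^ (mk [s] * g).norm ≤ 2 * √q * (√q)⁻¹ ^ g.norm := by
    intro g
    rcases hn : g.norm with _ | n
    · rw [norm_eq_zero.1 hn, sum_norm_mk_singleton (fun n => (√q)⁻¹ ^ n)]
      have : 2 * (Fintype.card α : ℝ) = √q * √q + 1 := by linarith
      rw [this, pow_one, pow_zero, mul_one, ← div_eq_mul_inv, div_le_iff₀ (by positivity)]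
      nlinarith
    · rw [sum_norm_mk_singleton_mul (fun n => (√q)⁻¹ ^ n) hn, ← hq]
      apply le_of_eq
      have : q * (√q)⁻¹ ^ (n + 2) = (√q)⁻¹ ^ n := by
        nth_rw 1 [← hsq]
        rw [pow_add]
        field_simp
      rw [this, pow_succ]
      field_simp
      ring
  refine lp.norm_sum_compPerm_le _ (h := fun g => (√q)⁻¹ ^ g.norm) (fun g => by positivity)
    (by positivity) key fun g => ?_
  simp only [Equiv.inv_mulLeft, Equiv.coe_mulLeft]
  rw [sum_inv_mk_singleton fun k : FreeGroup α => (√q)⁻¹ ^ (k * g).norm]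
  exact key g

variable (α) in
/-- The indicator function of the sphere of radius `k`, as an element of `ℓ²`. -/
noncomputable def sphere (k : ℕ) : lp (fun _ : FreeGroup α => ℂ) 2 :=
  ⟨fun g => if g.norm = k then 1 else 0,
    (memℓp_zero ((finite_norm_eq k).subset fun g => by simp)).of_exponent_ge zero_le⟩

theorem sphere_apply (k : ℕ) (g : FreeGroup α) : sphere α k g = if g.norm = k then 1 else 0 := rfl

theorem inner_sphere_of_ne {i j : ℕ} (hij : i ≠ j) :
    inner ℂ (sphere α i) (sphere α j) = 0 := by
  rw [lp.inner_eq_tsum]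
  convert tsum_zero with g
  rw [sphere_apply, sphere_apply]
  by_cases h : g.norm = i
  · simp [h, hij]
  · simp [h]

theorem sphere_zero_ne_zero : sphere α 0 ≠ 0 := by
  intro h
  have := congrArg (fun f : lp (fun _ : FreeGroup α => ℂ) 2 => f 1) h
  simp [sphere_apply] at this

theorem adjacency_sphere_zero : adjacency α (sphere α 0) = sphere α 1 := by
  ext g
  rw [adjacency_apply]
  simp only [sphere_apply]
  rcases hn : g.norm with _ | n
  · rw [norm_eq_zero.1 hn, sum_norm_mk_singleton (fun n => if n = 0 then (1 : ℂ) else 0)]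
    simp
  · rw [sum_norm_mk_singleton_mul (fun n => if n = 0 then (1 : ℂ) else 0) hn]
    simp

theorem adjacency_sphere_one : adjacency α (sphere α 1) =
    sphere α 2 + (((2 * (Fintype.card α : ℝ) - 1 : ℝ) + 1 : ℝ) : ℂ) • sphere α 0 := by
  ext g
  rw [adjacency_apply, lp.coeFn_add, lp.coeFn_smul, Pi.add_apply, Pi.smul_apply]
  simp only [sphere_apply]
  rcases hn : g.norm with _ | n
  · rw [norm_eq_zero.1 hn, sum_norm_mk_singleton (fun n => if n = 1 then (1 : ℂ) else 0)]
    simp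
  · rw [sum_norm_mk_singleton_mul (fun n => if n = 1 then (1 : ℂ) else 0) hn]
    simp

theorem adjacency_sphere_add_two (k : ℕ) : adjacency α (sphere α (k + 2)) =
    sphere α (k + 3) + ((2 * (Fintype.card α : ℝ) - 1 : ℝ) : ℂ) • sphere α (k + 1) := by
  ext g
  rw [adjacency_apply, lp.coeFn_add, lp.coeFn_smul, Pi.add_apply, Pi.smul_apply]
  simp only [sphere_apply]
  rcases hn : g.norm with _ | n
  · rw [norm_eq_zero.1 hn, sum_norm_mk_singleton (fun n => if n = k + 2 then (1 : ℂ) else 0)]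
    simp
  · rw [sum_norm_mk_singleton_mul (fun n => if n = k + 2 then (1 : ℂ) else 0) hn]
    simp

theorem spectrum_adjacency [Nonempty α] : spectrum ℂ (adjacency α) =
    Complex.ofReal '' Set.Icc (-(2 * √(2 * (Fintype.card α : ℝ) - 1)))
      (2 * √(2 * (Fintype.card α : ℝ) - 1)) := by
  have hcard : (1 : ℝ) ≤ Fintype.card α := by exact_mod_cast Fintype.card_pos
  ext z
  constructor
  · intro hz
    have hre := isSelfAdjoint_adjacency.mem_spectrum_eq_re hz
    refine ⟨z.re, abs_le.1 ?_, hre.symm⟩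
    calc |z.re| ≤ ‖z‖ := Complex.abs_re_le_norm z
      _ ≤ ‖adjacency α‖ * ‖(1 : lp (fun _ : FreeGroup α => ℂ) 2 →L[ℂ] _)‖ :=
          spectrum.norm_le_norm_mul_of_mem hz
      _ ≤ ‖adjacency α‖ * 1 := by gcongr; exact ContinuousLinearMap.norm_id_le
      _ ≤ _ := (mul_one _).trans_le norm_adjacency_le
  · rintro ⟨r, hr, rfl⟩
    exact mem_spectrum_of_orthogonal_recurrence isSelfAdjoint_adjacency (by linarith)
      (fun i j hij => inner_sphere_of_ne hij) sphere_zero_ne_zero adjacency_sphere_zero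
      adjacency_sphere_one adjacency_sphere_add_two (abs_le.2 hr)

end FreeGroup


/-- (Kesten) Let `F_m` be the free group on `m ≥ 1` generators and let `S` be the
symmetric set of the `m` generators and their inverses, of cardinality `v = 2m`.
The adjacency operator `A` on `ℓ²(F_m)`, `(A f)(g) = Σ_{s ∈ S} f(s⁻¹ g)`, is a
bounded self-adjoint operator whose spectrum equals the real interval
`[−2√(v−1), 2√(v−1)] = [−2√(2m−1), 2√(2m−1)]`. -/
theorem stmt_13 (m : ℕ) (hm : 1 ≤ m) :
    ∃ A : lp (fun _ : FreeGroup (Fin m) => ℂ) 2 →L[ℂ] lp (fun _ : FreeGroup (Fin m) => ℂ) 2,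
      (∀ (f : lp (fun _ : FreeGroup (Fin m) => ℂ) 2) (g : FreeGroup (Fin m)),
        (A f : ∀ _ : FreeGroup (Fin m), ℂ) g =
          ∑ i : Fin m,
            ((f : ∀ _ : FreeGroup (Fin m), ℂ) ((FreeGroup.of i)⁻¹ * g)
              + (f : ∀ _ : FreeGroup (Fin m), ℂ) (FreeGroup.of i * g))) ∧
      IsSelfAdjoint A ∧
      spectrum ℂ A =
        Complex.ofReal '' Set.Icc (-(2 * Real.sqrt (2 * (m : ℝ) - 1)))
          (2 * Real.sqrt (2 * (m : ℝ) - 1)) := by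
  have : Nonempty (Fin m) := ⟨⟨0, hm⟩⟩
  refine ⟨FreeGroup.adjacency (Fin m), fun f g => ?_, FreeGroup.isSelfAdjoint_adjacency, ?_⟩
  · rw [FreeGroup.adjacency_apply, Fintype.sum_prod_type]
    refine Finset.sum_congr rfl fun i _ => ?_
    rw [Fintype.sum_bool, add_comm]
    rfl
  · simpa using FreeGroup.spectrum_adjacency (α := Fin m)
end

section
/- (Kesten–McKay moment identity) Let m ≥ 1, v = 2m, and let N_e(n) be the number of n-tuples (s_1, …, s_n) from the symmetric generating set S of the free group F_m (the m generators and their inverses) with s_1 ⋯ s_n = 1. Then for every n ∈ ℕ, ∫_{−2√(v−1)}^{2√(v−1)} x^n · ( v·√(4(v−1) − x²) ) / ( 2π (v² − x²) ) dx = N_e(n). -/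
open FreeGroup in
theorem FreeGroup.norm_inv_mk_singleton_mul {α : Type*} [DecidableEq α] (p : α × Bool)
    (g : FreeGroup α) :
    ((mk [p])⁻¹ * g).norm = if g.toWord.head? = some p then g.norm - 1 else g.norm + 1 := by
  have h : (mk [p])⁻¹ * g = mk ((p.1, !p.2) :: g.toWord) := by
    conv_lhs => rw [← mk_toWord (x := g)]
    simp [inv_mk, invRev]
  have h₂ := reduce_toWord g
  rw [h, norm, norm, toWord_mk, reduce.cons, h₂]
  rcases g.toWord with _ | ⟨hd, tl⟩
  · simp
  · have : (p.1 = hd.1 ∧ (!p.2) = !hd.2) ↔ hd = p := by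
      rw [Prod.ext_iff]; simp [eq_comm]
    simp only [this, List.head?_cons, Option.some.injEq]
    split_ifs <;> simp

theorem FreeGroup.sum_norm_inv_mk_singleton_mul {α : Type*} [DecidableEq α] [Fintype α]
    (F : ℕ → ℝ) (g : FreeGroup α) :
    ∑ p : α × Bool, F ((mk [p])⁻¹ * g).norm =
      if g.norm = 0 then 2 * (Fintype.card α : ℝ) * F 1
      else F (g.norm - 1) + (2 * (Fintype.card α : ℝ) - 1) * F (g.norm + 1) := by
  simp only [norm_inv_mk_singleton_mul]
  rw [FreeGroup.norm]
  rcases h : g.toWord with _ | ⟨hd, tl⟩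
  · simp [mul_comm]
  · have h₁ (p : α × Bool) : F (if (hd :: tl).head? = some p then (hd :: tl).length - 1
        else (hd :: tl).length + 1) =
        F (tl.length + 2) + if hd = p then F tl.length - F (tl.length + 2) else 0 := by
      by_cases hp : hd = p <;> simp [hp]
    simp only [h₁, Finset.sum_add_distrib, Finset.sum_ite_eq]
    simp
    ring

/-- The number of words of length `n` in the generators and their inverses with product `g`. -/
noncomputable def FreeGroup.walkCount {α : Type*} [DecidableEq α] [Fintype α] (n : ℕ)
    (g : FreeGroup α) : ℕ :=
  Fintype.card {t : Fin n → α × Bool // (List.ofFn fun i => FreeGroup.mk [t i]).prod = g}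

theorem FreeGroup.walkCount_zero {α : Type*} [DecidableEq α] [Fintype α] (g : FreeGroup α) :
    g.walkCount 0 = if g.norm = 0 then 1 else 0 := by
  simp [walkCount, Fintype.card_subtype, eq_comm (a := g), Finset.filter_const]
  split_ifs <;> simp

theorem FreeGroup.walkCount_succ {α : Type*} [DecidableEq α] [Fintype α] (n : ℕ)
    (g : FreeGroup α) :
    g.walkCount (n + 1) = ∑ p : α × Bool, ((FreeGroup.mk [p])⁻¹ * g).walkCount n := by
  simp only [walkCount, Fintype.card_subtype, Finset.card_filter]
  rw [← (Fin.consEquiv fun _ : Fin (n + 1) => α × Bool).sum_comp, Fintype.sum_prod_type]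
  simp [Fin.consEquiv, List.ofFn_succ, eq_inv_mul_iff_mul_eq,
    -FreeGroup.inv_mk, -Finset.sum_boole]

theorem FreeGroup.natCard_generator_tuples {α : Type*} [DecidableEq α] [Fintype α] (n : ℕ)
    (g : FreeGroup α) :
    Nat.card {t : Fin n → FreeGroup α //
      (∀ i, t i ∈ Set.range (FreeGroup.of : α → FreeGroup α) ∪
        Set.range fun i : α => (FreeGroup.of i)⁻¹) ∧ (List.ofFn t).prod = g} =
      g.walkCount n := by
  have hinj : Function.Injective fun p : α × Bool => (FreeGroup.mk [p]) := by
    intro p p' h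
    have := congrArg FreeGroup.toWord h
    simpa [FreeGroup.toWord_mk] using this
  have hS : (Set.range (FreeGroup.of : α → FreeGroup α) ∪
      Set.range fun i : α => (FreeGroup.of i)⁻¹) =
      Set.range fun p : α × Bool => (FreeGroup.mk [p]) := by
    ext x
    simp [FreeGroup.of, FreeGroup.inv_mk, FreeGroup.invRev, or_comm, exists_or]
  rw [hS, walkCount, ← Nat.card_eq_fintype_card]
  symm
  refine Nat.card_congr (Equiv.ofBijective
    (fun t => ⟨fun i => FreeGroup.mk [t.1 i], fun i => ⟨t.1 i, rfl⟩, t.2⟩) ⟨?_, ?_⟩)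
  · intro t t' h
    ext1
    funext i
    exact hinj (congrFun (congrArg Subtype.val h) i)
  · rintro ⟨t, ht, hp⟩
    choose u hu using id ht
    obtain rfl : (fun i => FreeGroup.mk [u i]) = t := funext hu
    exact ⟨⟨u, hp⟩, rfl⟩

theorem integral_re_circleMap_of_diffContOnCl {f : ℂ → ℂ}
    (hf : DiffContOnCl ℂ f (Metric.ball 0 1))
    (hconj : ∀ z, f (starRingEnd ℂ z) = starRingEnd ℂ (f z)) :
    ∫ θ in (0 : ℝ)..Real.pi, (f (circleMap 0 1 θ)).re = Real.pi * (f 0).re := by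
  have hcont : Continuous fun θ : ℝ => f (circleMap 0 1 θ) := by
    have h := hf.continuousOn
    rw [closure_ball _ one_ne_zero] at h
    refine h.comp_continuous (continuous_circleMap 0 1) fun θ => ?_
    exact Metric.sphere_subset_closedBall (circleMap_mem_sphere 0 zero_le_one θ)
  have hre : Continuous fun θ : ℝ => (f (circleMap 0 1 θ)).re := Complex.continuous_re.comp hcont
  have h₁ : ∫ θ in (0 : ℝ)..2 * Real.pi, (f (circleMap 0 1 θ)).re = 2 * Real.pi * (f 0).re := by
    have h := DiffContOnCl.circleAverage (f := f) (c := 0) (R := 1) (by simpa using hf)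
    rw [Real.circleAverage_def] at h
    have h₂ : ∫ θ in (0 : ℝ)..2 * Real.pi, f (circleMap 0 1 θ) = (2 * Real.pi : ℝ) • f 0 := by
      rw [← h, smul_smul, mul_inv_cancel₀ (by positivity), one_smul]
    have h₃ := Complex.reCLM.intervalIntegral_comp_comm
      (hcont.intervalIntegrable (μ := MeasureTheory.volume) 0 (2 * Real.pi))
    rw [h₂] at h₃
    simpa using h₃
  have hsymm (θ : ℝ) : (f (circleMap 0 1 (2 * Real.pi - θ))).re = (f (circleMap 0 1 θ)).re := by
    have : circleMap 0 1 (2 * Real.pi - θ) = starRingEnd ℂ (circleMap 0 1 θ) := by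
      simp [circleMap, ← Complex.exp_conj, sub_mul, Complex.exp_sub, Complex.exp_neg]
    rw [this, hconj, Complex.conj_re]
  have h₂ : ∫ θ in Real.pi..2 * Real.pi, (f (circleMap 0 1 θ)).re =
      ∫ θ in (0 : ℝ)..Real.pi, (f (circleMap 0 1 θ)).re := by
    rw [← intervalIntegral.integral_congr (fun θ _ => hsymm θ),
      intervalIntegral.integral_comp_sub_left (fun θ => (f (circleMap 0 1 θ)).re)]
    congr 1 <;> ring
  rw [← intervalIntegral.integral_add_adjacent_intervals
    (hre.intervalIntegrable 0 Real.pi) (hre.intervalIntegrable _ _), h₂] at h₁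
  linarith

/-- The Kesten–McKay density of the `(s ^ 2 + 1)`-regular tree in the coordinate `θ`,
where `x = 2 * s * cos θ`. -/
noncomputable def kestenMcKayWeight (s θ : ℝ) : ℝ :=
  2 * (s ^ 2 + 1) * s ^ 2 * Real.sin θ ^ 2 /
    (Real.pi * ((s ^ 2 + 1) ^ 2 - (2 * s * Real.cos θ) ^ 2))

theorem integral_kestenMcKay_eq_integral_weight {s : ℝ} (hs : 0 < s) (F : ℝ → ℝ) :
    ∫ x in (-(2 * s))..(2 * s), F x * ((s ^ 2 + 1) * Real.sqrt (4 * s ^ 2 - x ^ 2)) /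
        (2 * Real.pi * ((s ^ 2 + 1) ^ 2 - x ^ 2)) =
      ∫ θ in (0 : ℝ)..Real.pi, F (2 * s * Real.cos θ) * kestenMcKayWeight s θ := by
  have himage : (fun θ => 2 * s * Real.cos θ) '' Set.Icc 0 Real.pi =
      Set.Icc (-(2 * s)) (2 * s) := by
    rw [← Function.comp_def (fun x => 2 * s * x) Real.cos, Set.image_comp,
      Real.bijOn_cos.image_eq, Set.image_mul_left_Icc (by positivity) (by norm_num)]
    simp
  have hinj : Set.InjOn (fun θ => 2 * s * Real.cos θ) (Set.Icc 0 Real.pi) := fun x hx y hy h =>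
    Real.injOn_cos hx hy (mul_left_cancel₀ (by positivity) h)
  rw [intervalIntegral.integral_of_le (by linarith), intervalIntegral.integral_of_le Real.pi_nonneg,
    ← MeasureTheory.integral_Icc_eq_integral_Ioc, ← MeasureTheory.integral_Icc_eq_integral_Ioc,
    ← himage, MeasureTheory.integral_image_eq_integral_abs_deriv_smul measurableSet_Icc
      (fun θ _ => ((Real.hasDerivAt_cos θ).const_mul (2 * s)).hasDerivWithinAt) hinj]
  refine MeasureTheory.setIntegral_congr_fun measurableSet_Icc fun θ hθ => ?_
  have hsin := Real.sin_nonneg_of_mem_Icc hθ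
  have hsqrt : Real.sqrt (4 * s ^ 2 - (2 * s * Real.cos θ) ^ 2) = 2 * s * Real.sin θ := by
    rw [← Real.sqrt_sq (show 0 ≤ 2 * s * Real.sin θ by positivity), mul_pow _ (Real.sin θ),
      Real.sin_sq]
    ring_nf
  have habs : |2 * s * -Real.sin θ| = 2 * s * Real.sin θ := by
    rw [mul_neg, abs_neg, abs_of_nonneg (by positivity)]
  simp only [hsqrt, habs, smul_eq_mul, kestenMcKayWeight]
  rw [mul_assoc 2 Real.pi, div_mul_eq_div_div _ 2]
  ring

theorem abs_kestenMcKayWeight_le {s : ℝ} (hs : 0 < s) (θ : ℝ) :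
    |kestenMcKayWeight s θ| ≤ (s ^ 2 + 1) / (2 * Real.pi) := by
  have hπ := Real.pi_pos
  have h : 4 * s ^ 2 * Real.sin θ ^ 2 ≤ (s ^ 2 + 1) ^ 2 - (2 * s * Real.cos θ) ^ 2 := by
    rw [Real.sin_sq]
    nlinarith [sq_nonneg (s ^ 2 - 1)]
  have h₀ : 0 ≤ (s ^ 2 + 1) ^ 2 - (2 * s * Real.cos θ) ^ 2 := h.trans' (by positivity)
  rw [kestenMcKayWeight, abs_of_nonneg (by positivity)]
  refine div_le_of_le_mul₀ (by positivity) (by positivity) ?_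
  rw [div_mul_eq_mul_div, le_div_iff₀ (by positivity)]
  have := mul_le_mul_of_nonneg_left h (show 0 ≤ (s ^ 2 + 1) * Real.pi by positivity)
  nlinarith

theorem intervalIntegrable_mul_kestenMcKayWeight {s : ℝ} (hs : 0 < s) {F : ℝ → ℝ}
    (hF : Continuous F) (a b : ℝ) :
    IntervalIntegrable (fun θ => F θ * kestenMcKayWeight s θ) MeasureTheory.volume a b := by
  refine (intervalIntegrable_const (c := (s ^ 2 + 1) / (2 * Real.pi))).mono_fun
    (Measurable.aestronglyMeasurable ?_) (.of_forall fun θ => ?_) |>.continuousOn_mul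
      hF.continuousOn
  · unfold kestenMcKayWeight
    fun_prop
  · exact (abs_kestenMcKayWeight_le hs θ).trans (le_abs_self _)

/-- The spherical functions of the `(q + 1)`-regular tree, as polynomials in the eigenvalue `x` of
the adjacency operator. -/
noncomputable def sphericalFunction (q x : ℝ) : ℕ → ℝ
  | 0 => 1
  | 1 => x / (q + 1)
  | k + 2 => (x * sphericalFunction q x (k + 1) - sphericalFunction q x k) / q

theorem continuous_sphericalFunction (q : ℝ) (k : ℕ) :
    Continuous fun x => sphericalFunction q x k := by
  induction k using Nat.twoStepInduction with
  | zero => simpa only [sphericalFunction] using continuous_const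
  | one => simpa only [sphericalFunction] using continuous_id'.div_const _
  | more k h₀ h₁ =>
    simpa only [sphericalFunction] using ((continuous_id'.fun_mul h₁).fun_sub h₀).div_const _

theorem sphericalFunction_mul_sin {s : ℝ} (hs : 0 < s) (θ : ℝ) (k : ℕ) :
    (s ^ 2 + 1) * s ^ k * Real.sin θ * sphericalFunction (s ^ 2) (2 * s * Real.cos θ) k =
      s ^ 2 * Real.sin ((k + 1) * θ) - Real.sin ((k - 1) * θ) := by
  induction k using Nat.twoStepInduction with
  | zero => simp [sphericalFunction]; ring
  | one =>
    simp only [sphericalFunction]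
    field_simp
    norm_num [Real.sin_two_mul]
    ring
  | more k h₀ h₁ =>
    have hrec (a : ℝ) : Real.sin ((a + 2) * θ) =
        2 * Real.cos θ * Real.sin ((a + 1) * θ) - Real.sin (a * θ) := by
      rw [show (a + 2) * θ = (a + 1) * θ + θ by ring, show a * θ = (a + 1) * θ - θ by ring,
        Real.sin_add, Real.sin_sub]
      ring
    have h₂ := hrec (k + 1)
    have h₃ := hrec (k - 1)
    simp only [sphericalFunction]
    push_cast at h₁ ⊢
    rw [show (k + 2 + 1 : ℝ) = k + 1 + 2 by ring, h₂, show (k + 2 - 1 : ℝ) = k - 1 + 2 by ring, h₃]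
    rw [show (k + 1 - 1 : ℝ) = k - 1 + 1 by ring] at h₁
    generalize sphericalFunction (s ^ 2) (2 * s * Real.cos θ) k = A at h₀ ⊢
    generalize sphericalFunction (s ^ 2) (2 * s * Real.cos θ) (k + 1) = B at h₁ ⊢
    have hdiv : (s ^ 2 + 1) * s ^ (k + 2) * Real.sin θ * ((2 * s * Real.cos θ * B - A) / s ^ 2) =
        2 * Real.cos θ * ((s ^ 2 + 1) * s ^ (k + 1) * Real.sin θ * B) -
          (s ^ 2 + 1) * s ^ k * Real.sin θ * A := by
      field_simp
      ring
    rw [hdiv, h₁, h₀]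
    ring

/-- A function whose real part on the unit circle is, up to a constant, the `k`-th spherical
function times the Kesten–McKay density. -/
noncomputable def sphericalKernel (s : ℝ) (k : ℕ) (z : ℂ) : ℂ :=
  z ^ k * ((1 - z ^ 2) / ((s : ℂ) ^ 2 - z ^ 2))

theorem sphericalFunction_mul_weight {s : ℝ} (hs : 0 < s) (θ : ℝ) (k : ℕ) :
    sphericalFunction (s ^ 2) (2 * s * Real.cos θ) k * kestenMcKayWeight s θ =
      s ^ 2 / (Real.pi * s ^ k) * (sphericalKernel s k (circleMap 0 1 θ)).re := by
  have hz : circleMap 0 1 θ = Complex.exp (θ * Complex.I) := by simp [circleMap]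
  have hpow (j : ℕ) : Complex.exp (θ * Complex.I) ^ j =
      Real.cos (j * θ) + Real.sin (j * θ) * Complex.I := by
    rw [← Complex.exp_nat_mul, ← mul_assoc, Complex.exp_mul_I]
    push_cast; rfl
  have hD : Complex.normSq ((s : ℂ) ^ 2 - circleMap 0 1 θ ^ 2) =
      (s ^ 2 + 1) ^ 2 - (2 * s * Real.cos θ) ^ 2 := by
    rw [hz, hpow, ← Complex.ofReal_pow]
    simp [Complex.normSq_apply, -Complex.ofReal_pow, -Complex.ofReal_cos, -Complex.ofReal_sin]
    rw [Real.cos_two_mul, Real.sin_two_mul]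
    have := Real.sin_sq_add_cos_sq θ
    linear_combination 4 * Real.cos θ ^ 2 * this
  have hN : (circleMap 0 1 θ ^ k * (1 - circleMap 0 1 θ ^ 2) *
      starRingEnd ℂ ((s : ℂ) ^ 2 - circleMap 0 1 θ ^ 2)).re =
      2 * Real.sin θ * (s ^ 2 * Real.sin ((k + 1) * θ) - Real.sin ((k - 1) * θ)) := by
    rw [hz, hpow, hpow, ← Complex.ofReal_pow]
    simp [-Complex.ofReal_pow, -Complex.ofReal_cos, -Complex.ofReal_sin]
    rw [show ((k : ℝ) + 1) * θ = k * θ + θ by ring, show ((k : ℝ) - 1) * θ = k * θ - θ by ring,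
      Real.cos_two_mul, Real.sin_two_mul, Real.sin_add, Real.sin_sub]
    linear_combination -(Real.cos (k * θ) * (2 * (s ^ 2 + 1) - 4 * Real.cos θ ^ 2)) *
      Real.sin_sq_add_cos_sq θ
  have hre : (sphericalKernel s k (circleMap 0 1 θ)).re =
      2 * Real.sin θ * (s ^ 2 * Real.sin ((k + 1) * θ) - Real.sin ((k - 1) * θ)) /
        ((s ^ 2 + 1) ^ 2 - (2 * s * Real.cos θ) ^ 2) := by
    rw [← hD, ← hN, sphericalKernel, ← mul_div_assoc, div_eq_mul_inv, Complex.inv_def, ← mul_assoc,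
      Complex.re_mul_ofReal, div_eq_mul_inv]
  rw [hre, ← sphericalFunction_mul_sin hs, kestenMcKayWeight, div_mul_div_comm, mul_div_assoc',
    ← mul_div_mul_left _ _ (pow_ne_zero k hs.ne')]
  congr 1 <;> ring

theorem integral_re_sphericalKernel {s : ℝ} (hs : 1 ≤ s) (k : ℕ) :
    ∫ θ in (0 : ℝ)..Real.pi, (sphericalKernel s k (circleMap 0 1 θ)).re =
      if k = 0 then Real.pi / s ^ 2 else 0 := by
  rcases hs.eq_or_lt with rfl | hs
  · have hae : ∀ᵐ θ : ℝ, θ ∈ Set.uIoc 0 Real.pi →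
        (sphericalKernel 1 k (circleMap 0 1 θ)).re = (circleMap 0 1 θ ^ k).re := by
      filter_upwards [MeasureTheory.Measure.ae_ne MeasureTheory.volume Real.pi] with θ hne hθ
      rw [Set.uIoc_of_le Real.pi_nonneg] at hθ
      have hsin : 0 < Real.sin θ := Real.sin_pos_of_pos_of_lt_pi hθ.1 (lt_of_le_of_ne hθ.2 hne)
      have : 1 - circleMap 0 1 θ ^ 2 ≠ 0 := by
        intro h
        have him : (circleMap 0 1 θ).im = Real.sin θ := by
          simp [circleMap, Complex.exp_ofReal_mul_I_im]
        rw [sub_eq_zero, eq_comm, sq, mul_self_eq_one_iff] at h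
        rcases h with h | h <;> simp [h] at him <;> linarith
      rw [sphericalKernel, Complex.ofReal_one, one_pow, div_self this, mul_one]
    rw [intervalIntegral.integral_congr_ae hae,
      integral_re_circleMap_of_diffContOnCl (f := fun z => z ^ k)
        (Differentiable.diffContOnCl (by fun_prop)) (by simp)]
    rcases eq_or_ne k 0 with rfl | hk <;> simp [*]
  · have hne {z : ℂ} (hz : ‖z‖ ≤ 1) : (s : ℂ) ^ 2 - z ^ 2 ≠ 0 := by
      intro h
      have h₁ : ‖(s : ℂ) ^ 2‖ = ‖z ^ 2‖ := by rw [sub_eq_zero.mp h]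
      rw [norm_pow, norm_pow, Complex.norm_real, Real.norm_of_nonneg (by linarith)] at h₁
      nlinarith [norm_nonneg z]
    rw [integral_re_circleMap_of_diffContOnCl]
    · rcases eq_or_ne k 0 with rfl | hk
      · have : sphericalKernel s 0 0 = ((s ^ 2)⁻¹ : ℝ) := by simp [sphericalKernel]
        rw [this, Complex.ofReal_re, if_pos rfl, div_eq_mul_inv]
      · simp [sphericalKernel, hk]
    · refine DifferentiableOn.diffContOnCl fun z hz => ?_
      rw [closure_ball _ one_ne_zero, mem_closedBall_zero_iff] at hz
      unfold sphericalKernel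
      exact DifferentiableAt.differentiableWithinAt (by fun_prop (disch := exact hne hz))
    · intro z
      simp [sphericalKernel]

theorem integral_sphericalFunction_mul_weight {s : ℝ} (hs : 1 ≤ s) (k : ℕ) :
    ∫ θ in (0 : ℝ)..Real.pi,
        sphericalFunction (s ^ 2) (2 * s * Real.cos θ) k * kestenMcKayWeight s θ =
      if k = 0 then 1 else 0 := by
  have hs₀ : 0 < s := by linarith
  simp only [sphericalFunction_mul_weight hs₀, intervalIntegral.integral_const_mul,
    integral_re_sphericalKernel hs]
  have := Real.pi_ne_zero
  split_ifs with hk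
  · subst hk
    field_simp
  · simp

theorem FreeGroup.walkCount_eq_integral {α : Type*} [DecidableEq α] [Fintype α] {s : ℝ}
    (hs : 1 ≤ s) (hcard : s ^ 2 = 2 * (Fintype.card α : ℝ) - 1) (n : ℕ) (g : FreeGroup α) :
    (g.walkCount n : ℝ) = ∫ θ in (0 : ℝ)..Real.pi, (2 * s * Real.cos θ) ^ n *
      sphericalFunction (s ^ 2) (2 * s * Real.cos θ) g.norm * kestenMcKayWeight s θ := by
  induction n generalizing g with
  | zero => simp [walkCount_zero, integral_sphericalFunction_mul_weight hs]
  | succ n ih =>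
    have hintegrable (k : ℕ) : IntervalIntegrable (fun θ => (2 * s * Real.cos θ) ^ n *
        sphericalFunction (s ^ 2) (2 * s * Real.cos θ) k * kestenMcKayWeight s θ)
        MeasureTheory.volume 0 Real.pi :=
      intervalIntegrable_mul_kestenMcKayWeight (by linarith) (by
        have := (continuous_sphericalFunction (s ^ 2) k).comp
          (show Continuous fun θ => 2 * s * Real.cos θ by fun_prop)
        exact Continuous.fun_mul (by fun_prop) this) _ _
    rw [walkCount_succ]
    push_cast
    simp only [ih]
    rw [← intervalIntegral.integral_finsetSum fun p _ => hintegrable _]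
    refine intervalIntegral.integral_congr fun θ _ => ?_
    rw [sum_norm_inv_mk_singleton_mul (fun k => (2 * s * Real.cos θ) ^ n *
      sphericalFunction (s ^ 2) (2 * s * Real.cos θ) k * kestenMcKayWeight s θ), ← hcard,
      show 2 * (Fintype.card α : ℝ) = s ^ 2 + 1 by linarith]
    rcases g.norm with _ | k
    · simp only [sphericalFunction, if_true, pow_succ _ n]
      field_simp
    · have hrec : s ^ 2 * sphericalFunction (s ^ 2) (2 * s * Real.cos θ) (k + 2) =
          2 * s * Real.cos θ * sphericalFunction (s ^ 2) (2 * s * Real.cos θ) (k + 1) -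
            sphericalFunction (s ^ 2) (2 * s * Real.cos θ) k := by
        rw [sphericalFunction, mul_div_cancel₀ _ (by positivity)]
      simp only [Nat.succ_ne_zero, if_false, Nat.add_sub_cancel, pow_succ _ n]
      linear_combination (2 * s * Real.cos θ) ^ n * kestenMcKayWeight s θ * hrec


/-- (Kesten–McKay moment identity) For `m ≥ 1` and `v = 2m`, the moments of the
Kesten–McKay density reproduce the numbers `N_e(n)` of closed paths of length `n`
at the identity in the standard Cayley graph of the free group `F_m`:
`∫_{−2√(v−1)}^{2√(v−1)} x^n · v√(4(v−1) − x²) / (2π(v² − x²)) dx = N_e(n)`. -/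
theorem stmt_16 (m : ℕ) (hm : 1 ≤ m) (n : ℕ) :
    (∫ x in (-(2 * Real.sqrt (2 * (m : ℝ) - 1)))..(2 * Real.sqrt (2 * (m : ℝ) - 1)),
        x ^ n * (2 * (m : ℝ) * Real.sqrt (4 * (2 * (m : ℝ) - 1) - x ^ 2)) /
          (2 * Real.pi * ((2 * (m : ℝ)) ^ 2 - x ^ 2)))
      = (Nat.card {t : Fin n → FreeGroup (Fin m) //
          (∀ i, t i ∈ Set.range (FreeGroup.of : Fin m → FreeGroup (Fin m)) ∪
            Set.range fun i : Fin m => (FreeGroup.of i)⁻¹) ∧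
          (List.ofFn t).prod = 1} : ℝ) := by
  have hm' : (1 : ℝ) ≤ m := by exact_mod_cast hm
  have hs : 1 ≤ Real.sqrt (2 * (m : ℝ) - 1) := Real.one_le_sqrt.mpr (by linarith)
  have hsq : Real.sqrt (2 * (m : ℝ) - 1) ^ 2 = 2 * m - 1 := Real.sq_sqrt (by linarith)
  rw [FreeGroup.natCard_generator_tuples, FreeGroup.walkCount_eq_integral hs (by simpa using hsq)]
  have h := integral_kestenMcKay_eq_integral_weight (by linarith) (fun x => x ^ n)
    (s := Real.sqrt (2 * (m : ℝ) - 1))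
  simp only [hsq, sub_add_cancel] at h
  rw [h]
  simp [sphericalFunction]
end
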